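/- arXiv:1410.4153 — 2 statements merged into one kernel-verified Lean document; each statement's English description precedes it below -/
import Mathlib

section
/- For every τ in the complex upper half-plane, ζ₅³·θ[1/5,3/5](τ)^5 + ζ₅⁴·θ[3/5,3/5](τ)^5 + θ[1,3/5](τ)^5 − ζ₅·θ[3/5,7/5](τ)^5 − ζ₅²·θ[1/5,7/5](τ)^5 = 0. -/
open Complex

/-- The theta constant with characteristic `[ε; ε']`:
`θ[ε,ε'](τ) = ∑_{n ∈ ℤ} exp(2πi((1/2)(n+ε/2)²τ + (n+ε/2)(ε'/2)))`. -/
noncomputable def θ (ε ε' : ℝ) (τ : ℂ) : ℂ :=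
  ∑' n : ℤ, Complex.exp (2 * Real.pi * Complex.I *
    ((1 / 2) * ((n : ℂ) + (ε : ℂ) / 2) ^ 2 * τ + ((n : ℂ) + (ε : ℂ) / 2) * ((ε' : ℂ) / 2)))

/-- `ζ₅ = exp(2πi/5)`. -/
noncomputable def ζ₅ : ℂ := Complex.exp (2 * Real.pi * Complex.I / 5)

/-- The general term of `θ[ε, 3/5](τ)`, evaluated at `x = n + ε/2`. -/
noncomputable def thetaTerm (τ : ℂ) (x : ℝ) : ℂ :=
  Complex.exp (2 * Real.pi * Complex.I * ((1 / 2) * (x : ℂ) ^ 2 * τ + (x : ℂ) * (3 / 10)))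

/-- The point `(2k + 1) / 10`, half of the characteristic `(2k + 1) / 5`. -/
noncomputable def halfChar (k : ℤ) : ℝ := (k : ℝ) / 5 + 1 / 10

/-- The theta constant `θ[(2k + 1)/5, 3/5](τ)`. -/
noncomputable def thetaConst (τ : ℂ) (k : ℤ) : ℂ := ∑' n : ℤ, thetaTerm τ (halfChar k + n)

/-- The term of `∑ₖ ζ₅ᵏ θ[(2k + 1)/5, 3/5](τ)⁵` in coordinates of the lattice generated by `ℤ⁵` and
`(1/5, …, 1/5)`. -/
noncomputable def quinticTerm (τ : ℂ) (p : ℤ × (ℤ × ℤ) × (ℤ × ℤ)) : ℂ :=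
  ζ₅ ^ p.1 * thetaTerm τ (halfChar p.1) *
    ((thetaTerm τ (halfChar p.1 + p.2.1.1) * thetaTerm τ (halfChar p.1 + p.2.1.2)) *
      (thetaTerm τ (halfChar p.1 + p.2.2.1) * thetaTerm τ (halfChar p.1 + p.2.2.2)))

theorem norm_thetaTerm (τ : ℂ) (x : ℝ) :
    ‖thetaTerm τ x‖ = Real.exp (-(Real.pi * τ.im) * x ^ 2) := by
  have h : 2 * Real.pi * Complex.I * ((1 / 2) * (x : ℂ) ^ 2 * τ + (x : ℂ) * (3 / 10)) =
      ((Real.pi * x ^ 2 : ℝ) : ℂ) * (τ * Complex.I) +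
        ((2 * Real.pi * x * (3 / 10) : ℝ) : ℂ) * Complex.I := by
    push_cast; ring
  rw [thetaTerm, Complex.norm_exp, h, Complex.add_re, Complex.re_ofReal_mul, Complex.re_ofReal_mul]
  simp only [Complex.mul_I_re, Complex.I_re]
  congr 1
  ring

theorem norm_ζ₅_zpow (k : ℤ) : ‖ζ₅ ^ k‖ = 1 := by
  have h : ‖ζ₅‖ = 1 := by
    rw [ζ₅, show 2 * Real.pi * Complex.I / 5 = ((2 * Real.pi / 5 : ℝ) : ℂ) * Complex.I by
      push_cast; ring]
    exact Complex.norm_exp_ofReal_mul_I _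
  rw [norm_zpow, h, one_zpow]

theorem ζ₅_pow_five : ζ₅ ^ 5 = 1 := by
  rw [ζ₅, ← Complex.exp_nat_mul]
  convert Complex.exp_two_pi_mul_I using 2
  push_cast; ring

theorem summable_exp_neg_mul_int_sq {c : ℝ} (hc : 0 < c) :
    Summable fun n : ℤ ↦ Real.exp (-c * (n : ℝ) ^ 2) := by
  have h := (hasSum_jacobiTheta₂_term 0 (τ := ((c / Real.pi : ℝ) : ℂ) * Complex.I)
    (by simp only [Complex.im_ofReal_mul, Complex.I_im]; positivity)).summable.norm
  refine h.congr fun n ↦ ?_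
  rw [norm_jacobiTheta₂_term, Complex.im_ofReal_mul, Complex.I_im, Complex.zero_im]
  congr 1
  field_simp
  ring

theorem summable_norm_thetaTerm {τ : ℂ} (hτ : 0 < τ.im) (a : ℝ) :
    Summable fun n : ℤ ↦ ‖thetaTerm τ (a + n)‖ := by
  have hc : 0 < Real.pi * τ.im := mul_pos Real.pi_pos hτ
  refine Summable.of_nonneg_of_le (fun _ ↦ norm_nonneg _) (fun n ↦ ?_)
    ((summable_exp_neg_mul_int_sq (half_pos hc)).mul_left (Real.exp (Real.pi * τ.im * a ^ 2)))
  rw [norm_thetaTerm, ← Real.exp_add, Real.exp_le_exp]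
  nlinarith [mul_nonneg hc.le (sq_nonneg ((n : ℝ) + 2 * a))]

theorem summable_quinticTerm {τ : ℂ} (hτ : 0 < τ.im) : Summable (quinticTerm τ) := by
  have hc : 0 < Real.pi * τ.im := mul_pos Real.pi_pos hτ
  have hk := (summable_exp_neg_mul_int_sq (div_pos hc (by norm_num : (0 : ℝ) < 250))).mul_left
    (Real.exp (Real.pi * τ.im / 500))
  have hm := summable_exp_neg_mul_int_sq (div_pos hc (by norm_num : (0 : ℝ) < 6))
  have hmm := hm.mul_of_nonneg hm (fun _ ↦ Real.exp_nonneg _) (fun _ ↦ Real.exp_nonneg _)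
  have h4 := hmm.mul_of_nonneg hmm (fun _ ↦ by positivity) (fun _ ↦ by positivity)
  have h5 := hk.mul_of_nonneg h4 (fun _ ↦ by positivity) (fun _ ↦ by positivity)
  refine Summable.of_norm_bounded h5 ?_
  rintro ⟨k, ⟨a, b⟩, c, d⟩
  simp only [quinticTerm, norm_mul, norm_ζ₅_zpow, norm_thetaTerm, one_mul, ← Real.exp_add,
    Real.exp_le_exp]
  set t := halfChar k with ht
  have key (m : ℤ) : (m : ℝ) ^ 2 / 6 ≤ (t + m) ^ 2 + t ^ 2 / 5 := by
    nlinarith [sq_nonneg ((5 : ℝ) * m + 6 * t)]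
  have hkey : (k : ℝ) ^ 2 / 250 - 1 / 500 ≤ t ^ 2 / 5 := by
    rw [ht, halfChar]; nlinarith [sq_nonneg ((k : ℝ) + 1)]
  nlinarith [mul_le_mul_of_nonneg_left (key a) hc.le, mul_le_mul_of_nonneg_left (key b) hc.le,
    mul_le_mul_of_nonneg_left (key c) hc.le, mul_le_mul_of_nonneg_left (key d) hc.le,
    mul_le_mul_of_nonneg_left hkey hc.le]

/-- The reflection negating the direction `(1, 1, 1, 1, 1)`. -/
def diagReflection : (ℤ × (ℤ × ℤ) × (ℤ × ℤ)) ≃ (ℤ × (ℤ × ℤ) × (ℤ × ℤ)) :=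
  Function.Involutive.toPerm
    (fun p ↦ (-1 - 2 * (p.2.1.1 + p.2.1.2 + p.2.2.1 + p.2.2.2) - p.1, p.2))
    (fun p ↦ by ext <;> simp)

theorem quinticTerm_diagReflection (τ : ℂ) (p : ℤ × (ℤ × ℤ) × (ℤ × ℤ)) :
    quinticTerm τ (diagReflection p) = -quinticTerm τ p := by
  obtain ⟨k, ⟨a, b⟩, c, d⟩ := p
  change quinticTerm τ (-1 - 2 * (a + b + c + d) - k, (a, b), c, d) = _
  rw [← neg_one_mul (quinticTerm _ _), ← Complex.exp_pi_mul_I]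
  simp only [quinticTerm, thetaTerm, halfChar, ζ₅, ← Complex.exp_int_mul, ← Complex.exp_add]
  refine Complex.exp_eq_exp_iff_exists_int.mpr ⟨-(a + b + c + d + k) - 1, ?_⟩
  push_cast
  ring

theorem tsum_quinticTerm (τ : ℂ) : ∑' p, quinticTerm τ p = 0 := by
  have h : ∑' p, quinticTerm τ p = -∑' p, quinticTerm τ p := by
    rw [← tsum_neg, ← diagReflection.tsum_eq (quinticTerm τ)]
    exact tsum_congr fun p ↦ quinticTerm_diagReflection τ p
  exact self_eq_neg.mp h

theorem tsum_pow_four {f : ℤ → ℂ} (hf : Summable fun n ↦ ‖f n‖) :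
    (∑' n, f n) ^ 4 =
      ∑' q : (ℤ × ℤ) × (ℤ × ℤ), f q.1.1 * f q.1.2 * (f q.2.1 * f q.2.2) := by
  have h2 : Summable fun q : ℤ × ℤ ↦ ‖f q.1 * f q.2‖ := hf.mul_norm hf
  rw [← tsum_mul_tsum_of_summable_norm h2 h2, ← tsum_mul_tsum_of_summable_norm hf hf]
  ring

theorem thetaConst_add_five_mul (τ : ℂ) (j n : ℤ) :
    thetaConst τ (j + 5 * n) = thetaConst τ j := by
  rw [thetaConst, thetaConst, ← (Equiv.addLeft n).tsum_eq fun m : ℤ ↦ thetaTerm τ (halfChar j + m)]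
  refine tsum_congr fun m ↦ congrArg _ ?_
  simp only [halfChar, Equiv.coe_addLeft]
  push_cast
  ring

theorem sum_ζ₅_pow_mul_thetaConst_pow_five {τ : ℂ} (hτ : 0 < τ.im) :
    ∑ j : Fin 5, ζ₅ ^ (j : ℕ) * thetaConst τ (j : ℕ) ^ 5 = 0 := by
  have hs := summable_quinticTerm hτ
  have hinner (k : ℤ) : ∑' q, quinticTerm τ (k, q) =
      ζ₅ ^ k * thetaTerm τ (halfChar k) * thetaConst τ k ^ 4 := by
    rw [thetaConst, tsum_pow_four (summable_norm_thetaTerm hτ _), ← tsum_mul_left]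
    rfl
  have hprod := hs.prod
  simp only [hinner] at hprod
  have hsum := (tsum_quinticTerm τ).symm.trans hs.tsum_prod
  simp only [hinner] at hsum
  obtain ⟨e, he⟩ : ∃ e : Fin 5 × ℤ ≃ ℤ, ∀ j n, e (j, n) = (j : ℕ) + 5 * n :=
    ⟨(Equiv.prodComm (Fin 5) ℤ).trans (Int.divModEquiv 5).symm, fun j n ↦ by
      simp [Int.divModEquiv]; ring⟩
  have hprod' : Summable fun p ↦ ζ₅ ^ e p * thetaTerm τ (halfChar (e p)) * thetaConst τ (e p) ^ 4 :=
    e.summable_iff.mpr hprod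
  rw [← e.tsum_eq, hprod'.tsum_prod, tsum_fintype] at hsum
  rw [hsum]
  refine Finset.sum_congr rfl fun j _ ↦ ?_
  have hζ : ζ₅ ≠ 0 := Complex.exp_ne_zero _
  have hterm (n : ℤ) : ζ₅ ^ e (j, n) * thetaTerm τ (halfChar (e (j, n))) *
      thetaConst τ (e (j, n)) ^ 4 =
      ζ₅ ^ (j : ℕ) * thetaConst τ (j : ℕ) ^ 4 * thetaTerm τ (halfChar (j : ℕ) + n) := by
    have hz : ζ₅ ^ (5 * n) = 1 := by
      rw [zpow_mul, show ζ₅ ^ (5 : ℤ) = 1 from mod_cast ζ₅_pow_five, one_zpow]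
    rw [he, thetaConst_add_five_mul, zpow_add₀ hζ, hz, zpow_natCast,
      show halfChar ((j : ℕ) + 5 * n) = halfChar (j : ℕ) + n by simp only [halfChar]; push_cast; ring]
    ring
  simp only [hterm, tsum_mul_left]
  rw [← thetaConst]
  ring

theorem θ_eq_thetaConst (τ : ℂ) (k : ℤ) : θ ((2 * k + 1) / 5) (3 / 5) τ = thetaConst τ k := by
  refine tsum_congr fun n ↦ ?_
  rw [thetaTerm, halfChar]
  congr 1
  push_cast
  ring

theorem θ_seven_fifths_pow_five (τ : ℂ) (k : ℤ) :
    θ ((2 * k + 1) / 5) (7 / 5) τ ^ 5 = -thetaConst τ (4 - k) ^ 5 := by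
  have h : θ ((2 * k + 1) / 5) (7 / 5) τ =
      Complex.exp (2 * Real.pi * Complex.I * ((2 * k + 1) / 10)) * thetaConst τ (4 - k) := by
    rw [thetaConst, ← tsum_mul_left, θ, ← (Equiv.subLeft (-1 : ℤ)).tsum_eq]
    refine tsum_congr fun n ↦ ?_
    rw [thetaTerm, halfChar, ← Complex.exp_add]
    refine Complex.exp_eq_exp_iff_exists_int.mpr ⟨-1 - n, ?_⟩
    simp only [Equiv.subLeft_apply]
    push_cast
    ring
  have hexp : Complex.exp (2 * Real.pi * Complex.I * ((2 * k + 1) / 10)) ^ 5 = -1 := by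
    rw [← Complex.exp_nat_mul, ← Complex.exp_pi_mul_I]
    refine Complex.exp_eq_exp_iff_exists_int.mpr ⟨k, ?_⟩
    push_cast
    ring
  rw [h, mul_pow, hexp, neg_one_mul]

theorem quintic_second_threefifths (τ : ℂ) (hτ : 0 < τ.im) :
    ζ₅ ^ 3 * θ (1/5) (3/5) τ ^ 5 + ζ₅ ^ 4 * θ (3/5) (3/5) τ ^ 5 + θ 1 (3/5) τ ^ 5 - ζ₅ * θ (3/5) (7/5) τ ^ 5 - ζ₅ ^ 2 * θ (1/5) (7/5) τ ^ 5 = 0 := by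
  have h0 := θ_eq_thetaConst τ 0
  have h1 := θ_eq_thetaConst τ 1
  have h2 := θ_eq_thetaConst τ 2
  have h3 := θ_seven_fifths_pow_five τ 1
  have h4 := θ_seven_fifths_pow_five τ 0
  have hsum := sum_ζ₅_pow_mul_thetaConst_pow_five hτ
  simp only [Fin.sum_univ_five] at hsum
  norm_num at h0 h1 h2 h3 h4 hsum
  norm_num
  rw [h0, h1, h2, h3, h4]
  linear_combination ζ₅ ^ 3 * hsum -
    (thetaConst τ 2 ^ 5 + ζ₅ * thetaConst τ 3 ^ 5 + ζ₅ ^ 2 * thetaConst τ 4 ^ 5) * ζ₅_pow_five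
end

section
/- For every τ in the complex upper half-plane, θ[1,1/5](τ)·θ[1/5,7/5](τ)³ = ζ₅²·( θ[3/5,9/5](τ)³·θ[1/5,1](τ) + ζ₅²·θ[3/5,3/5](τ)³·θ[1/5,9/5](τ) ). -/
open Complex

/-- The bijection splitting pairs of integers `(m, n)` according to the common parity of
`m + n` and `m - n`. -/
noncomputable def intPairParityEquiv : (ℤ × ℤ) ⊕ (ℤ × ℤ) ≃ ℤ × ℤ :=
  Equiv.ofBijective
    (Sum.elim (fun p => (p.1 + p.2, p.1 - p.2)) (fun p => (p.1 + p.2 + 1, p.1 - p.2))) <| by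
    constructor
    · rintro (⟨a, b⟩ | ⟨a, b⟩) (⟨c, d⟩ | ⟨c, d⟩) h <;>
        simp only [Sum.elim_inl, Sum.elim_inr, Prod.mk.injEq] at h
      · obtain ⟨rfl, rfl⟩ : a = c ∧ b = d := by omega
        rfl
      · omega
      · omega
      · obtain ⟨rfl, rfl⟩ : a = c ∧ b = d := by omega
        rfl
    · rintro ⟨m, n⟩
      rcases Int.even_or_odd' (m + n) with ⟨k, hk | hk⟩
      · exact ⟨Sum.inl (k, m - k), by simp only [Sum.elim_inl, Prod.mk.injEq]; omega⟩
      · exact ⟨Sum.inr (k, m - k - 1), by simp only [Sum.elim_inr, Prod.mk.injEq]; omega⟩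

theorem intPairParityEquiv_inl (p : ℤ × ℤ) :
    intPairParityEquiv (Sum.inl p) = (p.1 + p.2, p.1 - p.2) := rfl

theorem intPairParityEquiv_inr (p : ℤ × ℤ) :
    intPairParityEquiv (Sum.inr p) = (p.1 + p.2 + 1, p.1 - p.2) := rfl

theorem hasSum_jacobiTheta₂_mul (z w : ℂ) {τ : ℂ} (hτ : 0 < τ.im) :
    HasSum (fun p : ℤ × ℤ => jacobiTheta₂_term p.1 z τ * jacobiTheta₂_term p.2 w τ)
      (jacobiTheta₂ z τ * jacobiTheta₂ w τ) := by
  have hz := (summable_jacobiTheta₂_term_iff z τ).2 hτ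
  have hw := (summable_jacobiTheta₂_term_iff w τ).2 hτ
  have h := summable_mul_of_summable_norm hz.norm hw.norm
  rw [jacobiTheta₂, jacobiTheta₂, hz.tsum_mul_tsum hw h]
  exact h.hasSum

theorem jacobiTheta₂_add_mul_sub (x y : ℂ) {τ : ℂ} (hτ : 0 < τ.im) :
    jacobiTheta₂ (x + y) τ * jacobiTheta₂ (x - y) τ =
      jacobiTheta₂ (2 * x) (2 * τ) * jacobiTheta₂ (2 * y) (2 * τ) +
      Complex.exp (Real.pi * I * (2 * x + 2 * y + τ)) *
        (jacobiTheta₂ (2 * x + τ) (2 * τ) * jacobiTheta₂ (2 * y + τ) (2 * τ)) := by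
  have hτ' : 0 < (2 * τ).im := by simpa using hτ
  refine (intPairParityEquiv.hasSum_iff.2 (hasSum_jacobiTheta₂_mul (x + y) (x - y) hτ)).unique
    (HasSum.sum ?_ ?_)
  · refine (hasSum_jacobiTheta₂_mul (2 * x) (2 * y) hτ').congr_fun fun p => ?_
    simp only [Function.comp_apply, intPairParityEquiv_inl,
      jacobiTheta₂_term, ← Complex.exp_add]
    congr 1
    push_cast
    ring
  · refine ((hasSum_jacobiTheta₂_mul (2 * x + τ) (2 * y + τ) hτ').mul_left _).congr_fun fun p => ?_
    simp only [Function.comp_apply, intPairParityEquiv_inr,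
      jacobiTheta₂_term, ← Complex.exp_add]
    congr 1
    push_cast
    ring

/-- The odd Jacobi theta function, up to a factor depending only on `τ`. -/
noncomputable def oddTheta (τ u : ℂ) : ℂ :=
  Complex.exp (Real.pi * I * u) * jacobiTheta₂ (u + (1 + τ) / 2) τ

theorem oddTheta_add_one (τ u : ℂ) : oddTheta τ (u + 1) = -oddTheta τ u := by
  rw [oddTheta, oddTheta, add_right_comm, jacobiTheta₂_add_left, mul_add, Complex.exp_add, mul_one,
    Complex.exp_pi_mul_I]
  ring

theorem oddTheta_add_self (τ u : ℂ) :
    oddTheta τ (u + τ) = -Complex.exp (-Real.pi * I * (2 * u + τ)) * oddTheta τ u := by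
  have h : Complex.exp (Real.pi * I * (u + τ)) * Complex.exp (-Real.pi * I * (τ + 2 * (u + (1 + τ) / 2))) =
      Complex.exp (-Real.pi * I * (2 * u + τ)) * Complex.exp (Real.pi * I * u) * Complex.exp (-(Real.pi * I)) := by
    simp only [← Complex.exp_add]
    congr 1
    ring
  rw [oddTheta, oddTheta, add_right_comm, jacobiTheta₂_add_left', ← mul_assoc, h, Complex.exp_neg,
    Complex.exp_pi_mul_I]
  ring

theorem oddTheta_neg (τ u : ℂ) : oddTheta τ (-u) = -oddTheta τ u := by
  have h₁ : jacobiTheta₂ (-u + (1 + τ) / 2) τ = jacobiTheta₂ (u - (1 + τ) / 2) τ := by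
    rw [← jacobiTheta₂_neg_left]
    congr 1
    ring
  have h₂ : jacobiTheta₂ (u + (1 + τ) / 2) τ =
      Complex.exp (-Real.pi * I * (τ + 2 * (u - (1 + τ) / 2))) * jacobiTheta₂ (u - (1 + τ) / 2) τ := by
    rw [← jacobiTheta₂_add_left', ← jacobiTheta₂_add_left (u - (1 + τ) / 2 + τ)]
    congr 1
    ring
  have h₃ : Complex.exp (Real.pi * I * u) * Complex.exp (-Real.pi * I * (τ + 2 * (u - (1 + τ) / 2))) =
      Complex.exp (Real.pi * I * -u) * Complex.exp (Real.pi * I) := by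
    simp only [← Complex.exp_add]
    congr 1
    ring
  rw [oddTheta, oddTheta, h₁, h₂, ← mul_assoc, h₃, Complex.exp_pi_mul_I]
  ring

theorem oddTheta_add_mul_sub (x y : ℂ) {τ : ℂ} (hτ : 0 < τ.im) :
    oddTheta τ (x + y) * oddTheta τ (x - y) =
      Complex.exp (2 * Real.pi * I * x) * jacobiTheta₂ (2 * x + τ) (2 * τ) *
          jacobiTheta₂ (2 * y) (2 * τ) -
        jacobiTheta₂ (2 * x) (2 * τ) *
          (Complex.exp (2 * Real.pi * I * y) * jacobiTheta₂ (2 * y + τ) (2 * τ)) := by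
  have key := jacobiTheta₂_add_mul_sub (x + (1 + τ) / 2) y hτ
  have h₁ : jacobiTheta₂ (2 * (x + (1 + τ) / 2)) (2 * τ) =
      jacobiTheta₂ (2 * x + τ) (2 * τ) := by
    rw [← jacobiTheta₂_add_left (2 * x + τ)]
    congr 1
    ring
  have h₂ : jacobiTheta₂ (2 * (x + (1 + τ) / 2) + τ) (2 * τ) =
      Complex.exp (-Real.pi * I * (2 * τ + 2 * (2 * x))) * jacobiTheta₂ (2 * x) (2 * τ) := by
    rw [← jacobiTheta₂_add_left', ← jacobiTheta₂_add_left (2 * x + 2 * τ)]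
    congr 1
    ring
  have h₃ : Complex.exp (Real.pi * I * (x + y)) * Complex.exp (Real.pi * I * (x - y)) =
      Complex.exp (2 * Real.pi * I * x) := by
    rw [← Complex.exp_add]
    congr 1
    ring
  have h₄ : Complex.exp (2 * Real.pi * I * x) *
      Complex.exp (Real.pi * I * (2 * (x + (1 + τ) / 2) + 2 * y + τ)) *
        Complex.exp (-Real.pi * I * (2 * τ + 2 * (2 * x))) = -Complex.exp (2 * Real.pi * I * y) := by
    have h : -Complex.exp (2 * Real.pi * I * y) = Complex.exp (2 * Real.pi * I * y + Real.pi * I) := by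
      rw [Complex.exp_add, Complex.exp_pi_mul_I, mul_neg_one]
    rw [h]
    simp only [← Complex.exp_add]
    congr 1
    ring
  rw [h₁, h₂] at key
  rw [oddTheta, oddTheta, add_right_comm x y, sub_add_eq_add_sub x y]
  linear_combination Complex.exp (Real.pi * I * (x + y)) * Complex.exp (Real.pi * I * (x - y)) * key +
    (jacobiTheta₂ (2 * x + τ) (2 * τ) * jacobiTheta₂ (2 * y) (2 * τ) +
      Complex.exp (Real.pi * I * (2 * (x + (1 + τ) / 2) + 2 * y + τ)) *
        Complex.exp (-Real.pi * I * (2 * τ + 2 * (2 * x))) * jacobiTheta₂ (2 * x) (2 * τ) *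
          jacobiTheta₂ (2 * y + τ) (2 * τ)) * h₃ +
    jacobiTheta₂ (2 * x) (2 * τ) * jacobiTheta₂ (2 * y + τ) (2 * τ) * h₄

/-- The three-term (Weierstrass) identity for the odd theta function. -/
theorem oddTheta_three_term (a b c d : ℂ) {τ : ℂ} (hτ : 0 < τ.im) :
    oddTheta τ (a + b) * oddTheta τ (a - b) * (oddTheta τ (c + d) * oddTheta τ (c - d)) +
      oddTheta τ (b + c) * oddTheta τ (b - c) * (oddTheta τ (a + d) * oddTheta τ (a - d)) +
      oddTheta τ (c + a) * oddTheta τ (c - a) * (oddTheta τ (b + d) * oddTheta τ (b - d)) = 0 := by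
  simp only [oddTheta_add_mul_sub _ _ hτ]
  ring

theorem θ_eq_oddTheta (ε ε' : ℝ) (τ : ℂ) {α β u : ℂ} (hα : (ε : ℂ) = 1 + 2 * α)
    (hβ : (ε' : ℂ) = 1 + 2 * β) (hu : u = α * τ + β) :
    θ ε ε' τ = Complex.exp (Real.pi * I * (τ / 4 + 1 / 2 + α ^ 2 * τ + α + 2 * α * β)) *
      oddTheta τ u := by
  rw [oddTheta, ← mul_assoc, ← Complex.exp_add, jacobiTheta₂, ← tsum_mul_left, θ]
  refine tsum_congr fun n => ?_
  rw [jacobiTheta₂_term, ← Complex.exp_add, hα, hβ, hu]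
  congr 1
  ring

theorem oddTheta_fifths {τ : ℂ} (hτ : 0 < τ.im) :
    oddTheta τ (-2 / 5) * oddTheta τ (-2 / 5 * τ + 1 / 5) ^ 3 =
      -(Complex.exp (-Real.pi * I * (τ / 5)) *
        (oddTheta τ (-1 / 5 * τ + 2 / 5) ^ 3 * oddTheta τ (-2 / 5 * τ))) -
      Complex.exp (-Real.pi * I * (τ / 5 - 6 / 5)) *
        (oddTheta τ (-1 / 5 * τ - 1 / 5) ^ 3 * oddTheta τ (-2 / 5 * τ + 2 / 5)) := by
  have key := oddTheta_three_term (-1 / 5 * τ - 1 / 5) (1 / 5 * τ - 2 / 5) (-2 / 5 * τ + 1 / 5) 0 hτ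
  have e₁ : oddTheta τ (-1 / 5 * τ - 1 / 5 + (1 / 5 * τ - 2 / 5)) = oddTheta τ (-2 / 5) := by
    rw [← neg_neg (oddTheta τ (_ + _)), ← oddTheta_add_one, ← oddTheta_neg]
    congr 1
    ring
  have e₂ : -1 / 5 * τ - 1 / 5 - (1 / 5 * τ - 2 / 5) = -2 / 5 * τ + 1 / 5 := by ring
  have e₃ : 1 / 5 * τ - 2 / 5 + (-2 / 5 * τ + 1 / 5) = -1 / 5 * τ - 1 / 5 := by ring
  have e₄ : oddTheta τ (1 / 5 * τ - 2 / 5 - (-2 / 5 * τ + 1 / 5)) =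
      Complex.exp (-Real.pi * I * (τ / 5 - 6 / 5)) * oddTheta τ (-2 / 5 * τ + 2 / 5) := by
    rw [show 1 / 5 * τ - 2 / 5 - (-2 / 5 * τ + 1 / 5) = (-2 / 5 * τ - 3 / 5) + τ by ring,
      oddTheta_add_self, show -2 / 5 * τ + 2 / 5 = (-2 / 5 * τ - 3 / 5) + 1 by ring,
      oddTheta_add_one, neg_mul, mul_neg]
    congr 4
    ring
  have e₅ : oddTheta τ (-2 / 5 * τ + 1 / 5 + (-1 / 5 * τ - 1 / 5)) =
      Complex.exp (-Real.pi * I * (τ / 5)) * oddTheta τ (-2 / 5 * τ) := by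
    rw [show -2 / 5 * τ + 1 / 5 + (-1 / 5 * τ - 1 / 5) = -(-2 / 5 * τ + τ) by ring,
      oddTheta_neg, oddTheta_add_self, neg_mul, neg_neg]
    congr 3
    ring
  have e₆ : -2 / 5 * τ + 1 / 5 - (-1 / 5 * τ - 1 / 5) = -1 / 5 * τ + 2 / 5 := by ring
  have e₇ : oddTheta τ (1 / 5 * τ - 2 / 5) = -oddTheta τ (-1 / 5 * τ + 2 / 5) := by
    rw [← oddTheta_neg]
    congr 1
    ring
  simp only [add_zero, sub_zero] at key
  rw [e₁, e₂, e₃, e₄, e₅, e₆, e₇] at key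
  linear_combination key

theorem rational_expr_one_onefifth (τ : ℂ) (hτ : 0 < τ.im) :
    θ 1 (1/5) τ * θ (1/5) (7/5) τ ^ 3 = ζ₅ ^ 2 * (θ (3/5) (9/5) τ ^ 3 * θ (1/5) 1 τ + ζ₅ ^ 2 * θ (3/5) (3/5) τ ^ 3 * θ (1/5) (9/5) τ) := by
  have hz : ζ₅ ^ 2 = Complex.exp (Real.pi * I * (4 / 5)) := by
    rw [ζ₅, ← Complex.exp_nat_mul]
    congr 1
    push_cast
    ring
  rw [θ_eq_oddTheta 1 (1 / 5) τ (α := 0) (β := -2 / 5) (u := -2 / 5)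
      (by norm_num) (by norm_num) (by ring),
    θ_eq_oddTheta (1 / 5) (7 / 5) τ (α := -2 / 5) (β := 1 / 5) (by norm_num) (by norm_num) rfl,
    θ_eq_oddTheta (3 / 5) (9 / 5) τ (α := -1 / 5) (β := 2 / 5) (by norm_num) (by norm_num) rfl,
    θ_eq_oddTheta (1 / 5) 1 τ (α := -2 / 5) (β := 0) (u := -2 / 5 * τ)
      (by norm_num) (by norm_num) (by ring),
    θ_eq_oddTheta (3 / 5) (3 / 5) τ (α := -1 / 5) (β := -1 / 5) (u := -1 / 5 * τ - 1 / 5)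
      (by norm_num) (by norm_num) (by ring),
    θ_eq_oddTheta (1 / 5) (9 / 5) τ (α := -2 / 5) (β := 2 / 5) (by norm_num) (by norm_num) rfl, hz]
  have key := oddTheta_fifths hτ
  set K := Complex.exp (Real.pi * I * (τ / 4 + 1 / 2 + (0 : ℂ) ^ 2 * τ + 0 + 2 * 0 * (-2 / 5))) *
    Complex.exp (Real.pi * I * (τ / 4 + 1 / 2 + (-2 / 5) ^ 2 * τ + -2 / 5 + 2 * (-2 / 5) * (1 / 5))) ^ 3
    with hK
  have h₁ : Complex.exp (Real.pi * I * (4 / 5)) *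
      Complex.exp (Real.pi * I * (τ / 4 + 1 / 2 + (-1 / 5) ^ 2 * τ + -1 / 5 + 2 * (-1 / 5) * (2 / 5))) ^ 3 *
      Complex.exp (Real.pi * I * (τ / 4 + 1 / 2 + (-2 / 5) ^ 2 * τ + -2 / 5 + 2 * (-2 / 5) * 0)) =
      K * Complex.exp (-Real.pi * I * (τ / 5)) * Complex.exp (Real.pi * I) := by
    rw [hK]
    simp only [← Complex.exp_nat_mul, ← Complex.exp_add]
    congr 1
    push_cast
    ring
  have h₂ : Complex.exp (Real.pi * I * (4 / 5)) ^ 2 *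
      Complex.exp (Real.pi * I * (τ / 4 + 1 / 2 + (-1 / 5) ^ 2 * τ + -1 / 5 + 2 * (-1 / 5) * (-1 / 5))) ^ 3 *
      Complex.exp (Real.pi * I * (τ / 4 + 1 / 2 + (-2 / 5) ^ 2 * τ + -2 / 5 + 2 * (-2 / 5) * (2 / 5))) =
      K * Complex.exp (-Real.pi * I * (τ / 5 - 6 / 5)) * Complex.exp (Real.pi * I) := by
    rw [hK]
    simp only [← Complex.exp_nat_mul, ← Complex.exp_add]
    congr 1
    push_cast
    ring
  rw [Complex.exp_pi_mul_I] at h₁ h₂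
  linear_combination K * key -
    oddTheta τ (-1 / 5 * τ + 2 / 5) ^ 3 * oddTheta τ (-2 / 5 * τ) * h₁ -
    oddTheta τ (-1 / 5 * τ - 1 / 5) ^ 3 * oddTheta τ (-2 / 5 * τ + 2 / 5) * h₂
end
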